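/- Let m, n, ℓ ∈ ℕ, let V be a relatively open subset of the quadrant Q ⊆ ℝ^m × ℝ^n with 0 ∈ V, and let ψ : V → ℝ^ℓ be stratumwise smooth with 0 as a regular value. Then the stratification poset Δ(ψ) = {s : Fin m → Bool | ψ⁻¹(0) ∩ E_s ≠ ∅}, with the pointwise order, is cubical: for every s ∈ Δ(ψ), the subposet {t ∈ Δ(ψ) | s ≤ t} is order-isomorphic to the Boolean cube Fin (m − d(s)) → Bool with the pointwise order, where d(s) = #{i | s i = true}. -/

import Mathlib

/-- The closed quadrant `[0,∞)^m × ℝ^n ⊆ ℝ^m × ℝ^n`. -/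
def quadrant (m n : ℕ) : Set ((Fin m → ℝ) × (Fin n → ℝ)) :=
  {p | ∀ i, 0 ≤ p.1 i}

/-- The stratum `E_s` of the quadrant associated to `s : Fin m → Bool`:
`x i = 0` where `s i = false` and `x i > 0` where `s i = true`. -/
def stratum (m n : ℕ) (s : Fin m → Bool) : Set ((Fin m → ℝ) × (Fin n → ℝ)) :=
  {p | ∀ i, if s i then 0 < p.1 i else p.1 i = 0}

/-- The linear subspace of `ℝ^m × ℝ^n` containing the stratum `E_s`. -/
def stratumSpan (m n : ℕ) (s : Fin m → Bool) :
    Submodule ℝ ((Fin m → ℝ) × (Fin n → ℝ)) where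
  carrier := {p | ∀ i, s i = false → p.1 i = 0}
  add_mem' := by
    intro a b ha hb i hi
    show a.1 i + b.1 i = 0
    rw [ha i hi, hb i hi, add_zero]
  zero_mem' := by
    intro i _
    rfl
  smul_mem' := by
    intro c a ha i hi
    show c * a.1 i = 0
    rw [ha i hi, mul_zero]

open Module in
/-- The value at `1` of the polynomial `t ↦ det (1 + t A)` is an affine combination of its values at
points of any interval `(0, δ)`, with nodes and weights independent of `A`. -/
theorem exists_det_one_add_eq_sum (E : Type*) [NormedAddCommGroup E] [NormedSpace ℝ E]
    [FiniteDimensional ℝ E] {δ : ℝ} (hδ : 0 < δ) :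
    ∃ (N : ℕ) (v w : ℕ → ℝ), (∀ i, 0 < v i ∧ v i < δ) ∧ ∑ i ∈ Finset.range N, w i = 1 ∧
      ∀ A : E →L[ℝ] E, (1 + A).det = ∑ i ∈ Finset.range N, w i * (1 + v i • A).det := by
  set d := finrank ℝ E
  set v : ℕ → ℝ := fun i => δ / (i + 2) with hv
  have hvinj : Set.InjOn v (Finset.range (d + 1) : Set ℕ) := by
    intro i _ j _ hij
    have hi : (i : ℝ) + 2 ≠ 0 := by positivity
    have hj : (j : ℝ) + 2 ≠ 0 := by positivity
    simp only [hv] at hij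
    rw [div_eq_div_iff hi hj] at hij
    have := mul_left_cancel₀ hδ.ne' hij
    exact_mod_cast (by linarith : (i : ℝ) = j)
  refine ⟨d + 1, v, fun i => (Lagrange.basis (Finset.range (d + 1)) v i).eval 1,
    fun i => ⟨by simp only [hv]; positivity, ?_⟩, ?_, fun A => ?_⟩
  · simp only [hv]
    rw [div_lt_iff₀ (by positivity)]
    nlinarith [(Nat.cast_nonneg i : (0 : ℝ) ≤ i)]
  · rw [← Polynomial.eval_finsetSum, Lagrange.sum_basis hvinj ⟨0, by simp⟩, Polynomial.eval_one]
  · let b := finBasis ℝ E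
    let M := LinearMap.toMatrix b b (A : E →ₗ[ℝ] E)
    let p : Polynomial ℝ :=
      ((Polynomial.X : Polynomial ℝ) • M.map Polynomial.C + (1 : Matrix _ _ ℝ).map Polynomial.C).det
    have hp : ∀ t : ℝ, p.eval t = (1 + t • A).det := by
      intro t
      have h1 : p.eval t = (t • M + 1).det := by
        rw [← Polynomial.coe_evalRingHom, RingHom.map_det]
        congr 1
        ext i j
        by_cases hij : i = j <;> simp [hij, mul_comm t]
      have h2 : LinearMap.toMatrix b b ((1 + t • A : E →L[ℝ] E) : E →ₗ[ℝ] E) = t • M + 1 := by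
        rw [add_comm]
        change LinearMap.toMatrix b b (t • (A : E →ₗ[ℝ] E) + LinearMap.id) = _
        simp [M]
      rw [h1, ContinuousLinearMap.det, ← LinearMap.det_toMatrix b, h2]
    have hdeg : p.degree < (Finset.range (d + 1)).card := by
      rw [Finset.card_range]
      refine lt_of_le_of_lt Polynomial.degree_le_natDegree ?_
      have := Polynomial.natDegree_det_X_add_C_le M 1
      rw [Fintype.card_fin] at this
      exact_mod_cast Nat.lt_succ_of_le this
    have h := congrArg (Polynomial.eval (1 : ℝ)) (Lagrange.eq_interpolate hvinj hdeg)
    rw [hp, one_smul, Lagrange.interpolate_apply, Polynomial.eval_finsetSum] at h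
    rw [h]
    refine Finset.sum_congr rfl fun i _ => ?_
    rw [Polynomial.eval_mul, Polynomial.eval_C, hp, mul_comm]

/-- A function that is Lipschitz on the closed unit ball and vanishes on the unit sphere stays
Lipschitz, with the same constant, when extended by zero. -/
theorem LipschitzOnWith.lipschitzWith_indicator_closedBall {E F : Type*} [NormedAddCommGroup E]
    [NormedSpace ℝ E] [NormedAddCommGroup F] {k : E → F} {C : NNReal}
    (hk : LipschitzOnWith C k (Metric.closedBall 0 1)) (h0 : ∀ x, ‖x‖ = 1 → k x = 0) :
    LipschitzWith C ((Metric.closedBall (0 : E) 1).indicator k) := by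
  have mixed : ∀ x y : E, ‖x‖ ≤ 1 → 1 < ‖y‖ → ‖k x‖ ≤ C * dist x y := by
    intro x y hx hy
    obtain ⟨c, hc, hcz⟩ : ∃ c ∈ Set.Icc (0 : ℝ) 1, ‖AffineMap.lineMap x y c‖ = 1 := by
      have hcont : ContinuousOn (fun c : ℝ => ‖(AffineMap.lineMap x y c : E)‖) (Set.Icc 0 1) :=
        (AffineMap.lineMap_continuous.norm).continuousOn
      refine intermediate_value_Icc zero_le_one hcont ?_
      simpa using ⟨hx, hy.le⟩
    have h1 := hk.dist_le_mul x (by simpa using hx) (AffineMap.lineMap x y c) (by simp [hcz])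
    rw [h0 _ hcz, dist_zero_right, dist_left_lineMap, Real.norm_of_nonneg hc.1] at h1
    refine h1.trans (mul_le_mul_of_nonneg_left ?_ C.2)
    exact mul_le_of_le_one_left dist_nonneg hc.2
  refine LipschitzWith.of_dist_le_mul fun x y => ?_
  by_cases hx : ‖x‖ ≤ 1 <;> by_cases hy : ‖y‖ ≤ 1
  · rw [Set.indicator_of_mem (by simpa using hx), Set.indicator_of_mem (by simpa using hy)]
    exact hk.dist_le_mul x (by simpa using hx) y (by simpa using hy)
  · rw [Set.indicator_of_mem (by simpa using hx), Set.indicator_of_notMem (by simpa using hy),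
      dist_zero_right]
    exact mixed x y hx (not_le.1 hy)
  · rw [Set.indicator_of_notMem (by simpa using hx), Set.indicator_of_mem (by simpa using hy),
      dist_zero_left, dist_comm]
    exact mixed y x hy (not_le.1 hx)
  · rw [Set.indicator_of_notMem (by simpa using hx), Set.indicator_of_notMem (by simpa using hy),
      dist_self]
    positivity

/-- A small multiple of a Lipschitz perturbation vanishing on the sphere, added to the identity,
permutes the open unit ball. -/
theorem LipschitzOnWith.bijOn_ball_add_smul {E : Type*} [NormedAddCommGroup E]
    [NormedSpace ℝ E] [CompleteSpace E] {k : E → E} {C : NNReal}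
    (hk : LipschitzOnWith C k (Metric.closedBall 0 1)) (h0 : ∀ x, ‖x‖ = 1 → k x = 0)
    (hn : ∀ x, ‖x‖ ≤ 1 → ‖x + k x‖ ≤ 1) {t : ℝ} (ht : 0 < t) (ht1 : t < 1) (htC : t * C < 1) :
    Set.BijOn (fun x => x + t • k x) (Metric.ball 0 1) (Metric.ball 0 1) := by
  refine ⟨fun x hx => ?_, fun x hx y hy hxy => ?_, fun y hy => ?_⟩
  · rw [mem_ball_zero_iff] at hx ⊢
    have he : x + t • k x = (1 - t) • x + t • (x + k x) := by module
    calc ‖x + t • k x‖ ≤ ‖(1 - t) • x‖ + ‖t • (x + k x)‖ := he ▸ norm_add_le _ _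
      _ = (1 - t) * ‖x‖ + t * ‖x + k x‖ := by
        rw [norm_smul, norm_smul, Real.norm_of_nonneg ht.le, Real.norm_of_nonneg (by linarith)]
      _ < 1 := by nlinarith [hn x hx.le]
  · have h1 := hk.dist_le_mul x (Metric.ball_subset_closedBall hx) y
      (Metric.ball_subset_closedBall hy)
    have h2 : x - y = t • (k y - k x) := by
      have : x + t • k x = y + t • k y := hxy
      rw [smul_sub, sub_eq_sub_iff_add_eq_add, this, add_comm]
    have h3 : dist x y ≤ t * C * dist x y := by
      calc dist x y = t * dist (k x) (k y) := by
            rw [dist_eq_norm, h2, norm_smul, Real.norm_of_nonneg ht.le, dist_comm, dist_eq_norm]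
        _ ≤ _ := by rw [mul_assoc]; exact mul_le_mul_of_nonneg_left h1 ht.le
    by_contra hne
    nlinarith [dist_pos.2 hne]
  · have hL := hk.lipschitzWith_indicator_closedBall h0
    set K := (Metric.closedBall (0 : E) 1).indicator k with hK
    have hcontr : ContractingWith (t.toNNReal * C) (fun x => y - t • K x) := by
      refine ⟨?_, LipschitzWith.of_dist_le_mul fun a b => ?_⟩
      · rw [← NNReal.coe_lt_coe]
        simpa [ht.le] using htC
      · rw [dist_sub_left, dist_smul₀, Real.norm_of_nonneg ht.le, NNReal.coe_mul,
          Real.coe_toNNReal _ ht.le, mul_assoc]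
        exact mul_le_mul_of_nonneg_left (hL.dist_le_mul a b) ht.le
    obtain ⟨x, hx⟩ : ∃ x, y - t • K x = x :=
      ⟨_, ContractingWith.fixedPoint_isFixedPt hcontr⟩
    rw [mem_ball_zero_iff] at hy
    have hxball : ‖x‖ < 1 := by
      by_contra hx1
      have hKx : K x = 0 := by
        by_cases h : ‖x‖ ≤ 1
        · rw [hK, Set.indicator_of_mem (by simpa using h)]
          exact h0 x (le_antisymm h (not_lt.1 hx1))
        · exact Set.indicator_of_notMem (by simpa using h) _
      rw [hKx, smul_zero, sub_zero] at hx
      exact hx1 (hx ▸ hy)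
    refine ⟨x, by simpa using hxball, ?_⟩
    have hKx : K x = k x := Set.indicator_of_mem (by simpa using hxball.le) _
    change x + t • k x = y
    rw [← hKx]
    nth_rewrite 1 [← hx]
    abel

open MeasureTheory in
/-- There is no `C¹` retraction of the closed unit ball onto the unit sphere. -/
theorem not_contDiffOn_retraction_sphere {E : Type*} [NormedAddCommGroup E]
    [InnerProductSpace ℝ E] [FiniteDimensional ℝ E] {f : E → E} {U : Set E} (hU : IsOpen U)
    (hBU : Metric.closedBall 0 1 ⊆ U) (hf : ContDiffOn ℝ 1 f U) (hid : ∀ x, ‖x‖ = 1 → f x = x)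
    (hn : ∀ x, ‖x‖ ≤ 1 → ‖f x‖ = 1) : False := by
  let _ : MeasurableSpace E := borel E
  have _ : BorelSpace E := ⟨rfl⟩
  let k : E → E := fun x => f x - x
  have hkU : ContDiffOn ℝ 1 k U := hf.sub contDiffOn_id
  have hkdiff : ∀ x, ‖x‖ ≤ 1 → DifferentiableAt ℝ k x := fun x hx =>
    (hkU.differentiableOn one_ne_zero).differentiableAt (hU.mem_nhds (hBU (by simpa using hx)))
  have hk' : ContinuousOn (fderiv ℝ k) (Metric.closedBall 0 1) :=
    (hkU.continuousOn_fderiv_of_isOpen hU le_rfl).mono hBU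
  obtain ⟨C, hC⟩ := (isCompact_closedBall (0 : E) 1).exists_bound_of_continuousOn hk'
  have hC0 : 0 ≤ C := (norm_nonneg _).trans (hC 0 (by simp))
  lift C to NNReal using hC0
  have hkL : LipschitzOnWith C k (Metric.closedBall 0 1) :=
    (convex_closedBall 0 1).lipschitzOnWith_of_nnnorm_fderiv_le
      (fun x hx => hkdiff x (by simpa using hx)) fun x hx => hC x hx
  obtain ⟨η, hη, hdet⟩ : ∃ η > 0, ∀ M : E →L[ℝ] E, ‖M - 1‖ < η → 0 < M.det := by
    have h1 : (0 : ℝ) < (1 : E →L[ℝ] E).det := by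
      rw [ContinuousLinearMap.det, ContinuousLinearMap.toLinearMap_one, map_one]; exact one_pos
    obtain ⟨η, hη, h⟩ := Metric.eventually_nhds_iff.1
      ((ContinuousLinearMap.continuous_det (𝕜 := ℝ) (E := E)).continuousAt.eventually_const_lt h1)
    exact ⟨η, hη, fun M hM => h (by rwa [dist_eq_norm])⟩
  have hC1 : (0 : ℝ) < C + 1 := by positivity
  obtain ⟨N, v, w, hv, hw, hinterp⟩ := exists_det_one_add_eq_sum E
    (δ := min 1 (min 1 η / (C + 1))) (by positivity)
  have hball : MeasurableSet (Metric.ball (0 : E) 1) := Metric.isOpen_ball.measurableSet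
  have hvol : ∀ i, ∫ x in Metric.ball (0 : E) 1, (1 + v i • fderiv ℝ k x).det =
      volume.real (Metric.ball (0 : E) 1) := by
    intro i
    obtain ⟨hv0, hv1⟩ := hv i
    have hvC := (lt_div_iff₀ hC1).1 (hv1.trans_le (min_le_right _ _))
    have hbij := hkL.bijOn_ball_add_smul (t := v i) (fun x hx => by simp [k, hid x hx])
      (fun x hx => by simp [k, hn x hx]) hv0 (hv1.trans_le (min_le_left _ _))
      (by nlinarith [min_le_left 1 η])
    have h := integral_image_eq_integral_abs_det_fderiv_smul volume hball
      (f := fun x => x + v i • k x) (f' := fun x => 1 + v i • fderiv ℝ k x)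
      (fun x hx => ((hasFDerivAt_id x).add
        ((hkdiff x (by simpa using (mem_ball_zero_iff.1 hx).le)).hasFDerivAt.const_smul
          (v i))).hasFDerivWithinAt) hbij.injOn (fun _ => (1 : ℝ))
    rw [hbij.image_eq] at h
    simp only [smul_eq_mul, mul_one, integral_const, MeasurableSet.univ, measureReal_restrict_apply,
      Set.univ_inter] at h
    rw [h]
    refine setIntegral_congr_fun hball fun x hx => (abs_of_pos (hdet _ ?_)).symm
    rw [add_sub_cancel_left, norm_smul, Real.norm_of_nonneg hv0.le]
    have := hC x (Metric.ball_subset_closedBall hx)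
    nlinarith [min_le_right 1 η]
  have hintegrable : ∀ i, IntegrableOn (fun x => (1 + v i • fderiv ℝ k x).det)
      (Metric.ball (0 : E) 1) := fun i =>
    ((ContinuousLinearMap.continuous_det.comp_continuousOn
      (continuousOn_const.add (hk'.const_smul (v i)))).integrableOn_compact
        (isCompact_closedBall 0 1)).mono_set Metric.ball_subset_closedBall
  have htotal : ∫ x in Metric.ball (0 : E) 1, (1 + fderiv ℝ k x).det =
      volume.real (Metric.ball (0 : E) 1) := by
    rw [setIntegral_congr_fun hball fun x _ => hinterp (fderiv ℝ k x),
      integral_finsetSum _ fun i _ => (hintegrable i).const_mul (w i)]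
    simp_rw [integral_const_mul, hvol, ← Finset.sum_mul, hw, one_mul]
  have hzero : ∀ x ∈ Metric.ball (0 : E) 1, (1 + fderiv ℝ k x).det = 0 := by
    intro x hx
    have hx' : ‖x‖ < 1 := by simpa using hx
    have hfx : HasFDerivAt f (1 + fderiv ℝ k x) x := by
      have := (hasFDerivAt_id x).add (hkdiff x hx'.le).hasFDerivAt
      refine this.congr_of_eventuallyEq (Filter.Eventually.of_forall fun y => ?_)
      simp [k]
    have hconst : (fun y => ‖f y‖ ^ 2) =ᶠ[nhds x] fun _ => (1 : ℝ) := by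
      filter_upwards [Metric.isOpen_ball.mem_nhds hx] with y hy
      rw [hn y (mem_ball_zero_iff.1 hy).le, one_pow]
    have horth : ∀ u, inner ℝ (f x) ((1 + fderiv ℝ k x) u) = 0 := by
      intro u
      have := hfx.norm_sq.unique ((hasFDerivAt_const (1 : ℝ) x).congr_of_eventuallyEq hconst)
      have h2 : 2 * inner ℝ (f x) ((1 + fderiv ℝ k x) u) = 0 := by
        simpa [inner_add_right, mul_add] using congrArg (fun L => L u) this
      linarith
    by_contra hne
    obtain ⟨u, hu⟩ := (LinearMap.equivOfDetNeZero _ hne).surjective (f x)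
    have h1 := horth u
    rw [show (1 + fderiv ℝ k x) u = f x from hu, real_inner_self_eq_norm_sq, hn x hx'.le] at h1
    norm_num at h1
  rw [setIntegral_congr_fun hball hzero, integral_zero] at htotal
  have : 0 < volume.real (Metric.ball (0 : E) 1) :=
    ENNReal.toReal_pos (Metric.measure_ball_pos volume 0 one_pos).ne' measure_ball_lt_top.ne
  exact this.ne htotal

/-- A `C¹` vector field on the closed unit ball that points outwards along the unit sphere has a
zero. -/
theorem exists_zero_of_inner_pos_of_contDiffOn {E : Type*} [NormedAddCommGroup E]
    [InnerProductSpace ℝ E] [FiniteDimensional ℝ E] {g : E → E} {U : Set E} (hU : IsOpen U)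
    (hBU : Metric.closedBall 0 1 ⊆ U) (hg : ContDiffOn ℝ 1 g U)
    (hpos : ∀ x, ‖x‖ = 1 → 0 < inner ℝ x (g x)) : ∃ x, ‖x‖ ≤ 1 ∧ g x = 0 := by
  by_contra! hne
  let D : E → ℝ := fun x => inner ℝ x (g x) ^ 2 + ‖g x‖ ^ 2 * (1 - ‖x‖ ^ 2)
  have hD1 : ContDiffOn ℝ 1 D U := by
    have hx : ContDiffOn ℝ 1 (fun x : E => x) U := contDiffOn_id
    exact ((hx.inner ℝ hg).pow 2).add ((hg.norm_sq ℝ).mul (contDiffOn_const.sub (hx.norm_sq ℝ)))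
  have hDpos : ∀ x, ‖x‖ ≤ 1 → 0 < D x := by
    intro x hx
    have hgx : 0 < ‖g x‖ ^ 2 := by have := norm_pos_iff.2 (hne x hx); positivity
    rcases hx.eq_or_lt with h | h
    · have := hpos x h
      simp only [D, h]
      nlinarith
    · have : 0 < 1 - ‖x‖ ^ 2 := by nlinarith [norm_nonneg x]
      simp only [D]
      positivity
  let W : Set E := U ∩ {x | D x ≠ 0} ∩ {x | g x ≠ 0}
  have hWU : W ⊆ U := fun x hx => hx.1.1
  have hW : IsOpen W := by
    have h1 : IsOpen (U ∩ {x | D x ≠ 0}) :=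
      hD1.continuousOn.isOpen_inter_preimage hU isOpen_ne
    exact (hg.continuousOn.mono Set.inter_subset_left).isOpen_inter_preimage h1 isOpen_ne
  let lam : E → ℝ := fun x => (Real.sqrt (D x) - inner ℝ x (g x)) / ‖g x‖ ^ 2
  refine not_contDiffOn_retraction_sphere (f := fun x => x + lam x • g x) hW
    (fun x hx => ?_) ?_ (fun x hx => ?_) (fun x hx => ?_)
  · rw [mem_closedBall_zero_iff] at hx
    exact ⟨⟨hBU (by simpa using hx), (hDpos x hx).ne'⟩, hne x hx⟩
  · have hx : ContDiffOn ℝ 1 (fun x : E => x) W := contDiffOn_id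
    have hgW := hg.mono hWU
    refine hx.add (ContDiffOn.smul (((hD1.mono hWU).sqrt fun x hx => hx.1.2).sub
      (hx.inner ℝ hgW) |>.div (hgW.norm_sq ℝ) fun x hx => ?_) hgW)
    exact pow_ne_zero 2 (norm_ne_zero_iff.2 hx.2)
  · have : D x = inner ℝ x (g x) ^ 2 := by simp [D, hx]
    simp [lam, this, Real.sqrt_sq (hpos x hx).le]
  · have hgx : ‖g x‖ ≠ 0 := norm_ne_zero_iff.2 (hne x hx)
    have hs := Real.sq_sqrt (hDpos x hx).le
    have hl : lam x * ‖g x‖ ^ 2 = Real.sqrt (D x) - inner ℝ x (g x) := by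
      simp only [lam]; field_simp
    have h1 : ‖x + lam x • g x‖ ^ 2 = 1 := by
      rw [norm_add_sq_real, inner_smul_right, norm_smul, mul_pow, Real.norm_eq_abs, sq_abs]
      have h2 : ‖g x‖ ^ 2 * (‖x‖ ^ 2 + 2 * (lam x * inner ℝ x (g x)) + lam x ^ 2 * ‖g x‖ ^ 2 - 1)
          = 0 := by
        have h3 : (lam x * ‖g x‖ ^ 2 + inner ℝ x (g x)) ^ 2 = D x := by
            rw [hl, sub_add_cancel, hs]
        simp only [D] at h3
        linear_combination h3
      have := (mul_eq_zero.1 h2).resolve_left (pow_ne_zero 2 hgx)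
      linarith
    exact (sq_eq_sq₀ (norm_nonneg _) zero_le_one).1 (by rw [h1, one_pow])

theorem stratum_subset_quadrant (m n : ℕ) (s : Fin m → Bool) :
    stratum m n s ⊆ quadrant m n := by
  intro p hp i
  have := hp i
  split_ifs at this
  · exact this.le
  · exact this.ge

theorem mem_stratum_iff {m n : ℕ} {s : Fin m → Bool} {p : (Fin m → ℝ) × (Fin n → ℝ)} :
    p ∈ stratum m n s ↔ (∀ i, s i = true → 0 < p.1 i) ∧ p ∈ stratumSpan m n s := by
  refine ⟨fun h => ⟨fun i hi => ?_, fun i hi => ?_⟩, fun h i => ?_⟩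
  · simpa [hi] using h i
  · simpa [hi] using h i
  · cases hi : s i
    · simpa using h.2 i hi
    · simpa using h.1 i hi

theorem stratumSpan_mono (m n : ℕ) {s t : Fin m → Bool} (hst : s ≤ t) :
    stratumSpan m n s ≤ stratumSpan m n t := by
  intro p hp i hi
  exact hp i (Bool.eq_false_of_le_false (hi ▸ hst i))

theorem isOpen_coordinates_pos (m n : ℕ) (s : Fin m → Bool) :
    IsOpen {p : (Fin m → ℝ) × (Fin n → ℝ) | ∀ i, s i = true → 0 < p.1 i} := by
  have : {p : (Fin m → ℝ) × (Fin n → ℝ) | ∀ i, s i = true → 0 < p.1 i} =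
      ⋂ i, {p | s i = true → 0 < p.1 i} := by ext; simp
  rw [this]
  refine isOpen_iInter_of_finite fun i => ?_
  by_cases hi : s i = true
  · simpa [hi] using isOpen_lt continuous_const ((continuous_apply i).comp continuous_fst)
  · simp [hi]

theorem isOpen_preimage_inter_stratum {m n : ℕ} {U : Set ((Fin m → ℝ) × (Fin n → ℝ))}
    (hU : IsOpen U) (s : Fin m → Bool) :
    IsOpen {p : stratumSpan m n s |
      (p : (Fin m → ℝ) × (Fin n → ℝ)) ∈ (U ∩ quadrant m n) ∩ stratum m n s} := by
  have : {p : stratumSpan m n s |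
      (p : (Fin m → ℝ) × (Fin n → ℝ)) ∈ (U ∩ quadrant m n) ∩ stratum m n s} =
      Subtype.val ⁻¹' (U ∩ {p | ∀ i, s i = true → 0 < p.1 i}) := by
    ext p
    constructor
    · rintro ⟨⟨h1, _⟩, h2⟩
      exact ⟨h1, (mem_stratum_iff.1 h2).1⟩
    · rintro ⟨h1, h2⟩
      have := mem_stratum_iff.2 ⟨h2, p.2⟩
      exact ⟨⟨h1, stratum_subset_quadrant m n s this⟩, this⟩
  rw [this]
  exact (hU.inter (isOpen_coordinates_pos m n s)).preimage continuous_subtype_val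

/-- A regular zero on the stratum `E_s` can be pushed into any larger stratum `E_t` in which the
map is `C¹`. -/
theorem exists_zero_stratum_of_le {m n : ℕ} {E F : Type*} [NormedAddCommGroup E]
    [InnerProductSpace ℝ E] [FiniteDimensional ℝ E] [NormedAddCommGroup F] [NormedSpace ℝ F]
    (L : E ≃L[ℝ] F) {U : Set ((Fin m → ℝ) × (Fin n → ℝ))} (hU : IsOpen U)
    {ψ : ((Fin m → ℝ) × (Fin n → ℝ)) → F}
    (hcont : ContinuousOn ψ (U ∩ quadrant m n)) {s t : Fin m → Bool} (hst : s ≤ t)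
    (hsmooth : ContDiffOn ℝ 1 (fun p : stratumSpan m n t => ψ p)
      {p : stratumSpan m n t |
        (p : (Fin m → ℝ) × (Fin n → ℝ)) ∈ (U ∩ quadrant m n) ∩ stratum m n t})
    {z : stratumSpan m n s}
    (hz : (z : (Fin m → ℝ) × (Fin n → ℝ)) ∈ (U ∩ quadrant m n) ∩ stratum m n s)
    (hψz : ψ z = 0) {T : stratumSpan m n s →L[ℝ] F}
    (hT : HasFDerivAt (fun p : stratumSpan m n s => ψ p) T z) (hTsurj : Function.Surjective T) :
    ∃ p ∈ (U ∩ quadrant m n) ∩ stratum m n t, ψ p = 0 := by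
  have : FiniteDimensional ℝ F := L.toLinearEquiv.finiteDimensional
  obtain ⟨B, hB⟩ := T.exists_rightInverse_of_surjective (LinearMap.range_eq_top.2 hTsurj)
  let A : E →L[ℝ] stratumSpan m n s := B.comp (L : E →L[ℝ] F)
  let v : (Fin m → ℝ) × (Fin n → ℝ) := (fun i => if s i = false ∧ t i = true then 1 else 0, 0)
  let γ : ℝ × E → (Fin m → ℝ) × (Fin n → ℝ) := fun q => ((z + A q.2 : stratumSpan m n s) :
    (Fin m → ℝ) × (Fin n → ℝ)) + |q.1| • v
  have hγ : Continuous γ :=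
    (continuous_subtype_val.comp (continuous_const.add (A.continuous.comp continuous_snd))).add
      (continuous_fst.abs.smul continuous_const)
  have hγfalse : ∀ q i, s i = false → (γ q).1 i = |q.1| * v.1 i := by
    intro q i hi
    have : ((z + A q.2 : stratumSpan m n s) : (Fin m → ℝ) × (Fin n → ℝ)).1 i = 0 :=
      (z + A q.2).2 i hi
    change ((z + A q.2 : stratumSpan m n s) : (Fin m → ℝ) × (Fin n → ℝ)).1 i + |q.1| * v.1 i = _
    rw [this, zero_add]
  have hv0 : ∀ i, 0 ≤ v.1 i := fun i => by simp only [v]; split_ifs <;> norm_num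
  let O : Set (ℝ × E) := γ ⁻¹' (U ∩ {p | ∀ i, s i = true → 0 < p.1 i})
  have hO : IsOpen O := (hU.inter (isOpen_coordinates_pos m n s)).preimage hγ
  have hOV : Set.MapsTo γ O (U ∩ quadrant m n) := by
    refine fun q hq => ⟨hq.1, fun i => ?_⟩
    cases hi : s i
    · rw [hγfalse q i hi]
      exact mul_nonneg (abs_nonneg _) (hv0 i)
    · exact (hq.2 i hi).le
  have hspan : ∀ q, γ q ∈ stratumSpan m n t := by
    intro q i hi
    have hsi : s i = false := Bool.eq_false_of_le_false (hi ▸ hst i)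
    rw [hγfalse q i hsi]
    simp [v, hi]
  have hstratum : ∀ q ∈ O, q.1 ≠ 0 → γ q ∈ stratum m n t := by
    refine fun q hq hq0 => mem_stratum_iff.2 ⟨fun i hi => ?_, hspan q⟩
    cases hsi : s i
    · rw [hγfalse q i hsi]
      simpa [v, hsi, hi] using hq0
    · exact hq.2 i hsi
  let G : ℝ × E → E := fun q => L.symm (ψ (γ q))
  have hG : ContinuousOn G O :=
    L.symm.continuous.comp_continuousOn (hcont.comp hγ.continuousOn hOV)
  have hγ0 : ∀ x, γ (0, x) = ((z + A x : stratumSpan m n s) : (Fin m → ℝ) × (Fin n → ℝ)) := by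
    intro x; simp [γ]
  have h0O : ((0 : ℝ), (0 : E)) ∈ O := by
    have : γ (0, 0) = z := by rw [hγ0, map_zero, add_zero]
    simp only [O, Set.mem_preimage, this]
    exact ⟨hz.1.1, (mem_stratum_iff.1 hz.2).1⟩
  have hderiv : HasFDerivAt (fun x => G (0, x)) (ContinuousLinearMap.id ℝ E) 0 := by
    have h1 : HasFDerivAt (fun x : E => z + A x) A 0 := A.hasFDerivAt.const_add z
    have h2 : HasFDerivAt (fun x : E => ψ (z + A x : stratumSpan m n s)) (T.comp A) 0 :=
      HasFDerivAt.comp (g := fun p : stratumSpan m n s => ψ p) (0 : E)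
        (by rwa [map_zero, add_zero]) h1
    have h3 := (L.symm : F →L[ℝ] E).hasFDerivAt.comp (0 : E) h2
    have h4 : (L.symm : F →L[ℝ] E).comp (T.comp A) = ContinuousLinearMap.id ℝ E := by
      ext1 x
      have : T (B (L x)) = L x := congrArg (fun R => R (L x)) hB
      simp [A, this]
    rw [h4] at h3
    refine h3.congr_of_eventuallyEq (Filter.Eventually.of_forall fun x => ?_)
    simp only [G, hγ0]
    rfl
  have hG0 : G (0, 0) = 0 := by simp [G, hγ0, hψz]
  obtain ⟨r, hr, hrO, hrG⟩ : ∃ r > 0, (∀ x : E, ‖x‖ ≤ r → ((0 : ℝ), x) ∈ O) ∧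
      ∀ x : E, ‖x‖ ≤ r → ‖G (0, x) - x‖ ≤ 1 / 2 * ‖x‖ := by
    have h1 : ∀ᶠ x : E in nhds 0, ((0 : ℝ), x) ∈ O :=
      (Continuous.prodMk_right (0 : ℝ)).continuousAt.preimage_mem_nhds (hO.mem_nhds h0O)
    have h2 := (hasFDerivAt_iff_isLittleO_nhds_zero.1 hderiv).def
      (show (0 : ℝ) < 1 / 2 by norm_num)
    obtain ⟨r, hr, h⟩ := Metric.nhds_basis_closedBall.eventually_iff.1 (h1.and h2)
    refine ⟨r, hr, fun x hx => (h (by simpa using hx)).1, fun x hx => ?_⟩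
    simpa [hG0] using (h (show x ∈ Metric.closedBall 0 r by simpa using hx)).2
  have hev1 : ∀ᶠ ε : ℝ in nhds 0, ∀ x ∈ Metric.closedBall (0 : E) r, (ε, x) ∈ O :=
    (isCompact_closedBall (0 : E) r).eventually_forall_of_forall_eventually fun x hx =>
      hO.mem_nhds (hrO x (by simpa using hx))
  have hev2 : ∀ᶠ ε : ℝ in nhds 0, ∀ x ∈ Metric.sphere (0 : E) r, 0 < inner ℝ x (G (ε, x)) := by
    refine (isCompact_sphere (0 : E) r).eventually_forall_of_forall_eventually fun x hx => ?_
    have hxr : ‖x‖ = r := by simpa using hx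
    have hcontAt : ContinuousAt (fun q : ℝ × E => inner ℝ q.2 (G q)) (0, x) :=
      continuousAt_snd.inner (𝕜 := ℝ) (hG.continuousAt (hO.mem_nhds (hrO x hxr.le)))
    refine hcontAt.eventually_const_lt ?_
    have h1 : inner ℝ x (G (0, x)) = ‖x‖ ^ 2 + inner ℝ x (G (0, x) - x) := by
      rw [inner_sub_right, real_inner_self_eq_norm_sq]; ring
    have h2 := (abs_le.1 (abs_real_inner_le_norm x (G (0, x) - x))).1
    have h3 := mul_le_mul_of_nonneg_left (hrG x hxr.le) (norm_nonneg x)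
    change 0 < inner ℝ x (G (0, x))
    rw [h1]
    rw [hxr] at *
    nlinarith [mul_pos hr hr]
  obtain ⟨ε, ⟨hεO, hεG⟩, hε⟩ : ∃ ε : ℝ, ((∀ x ∈ Metric.closedBall (0 : E) r, (ε, x) ∈ O) ∧
      ∀ x ∈ Metric.sphere (0 : E) r, 0 < inner ℝ x (G (ε, x))) ∧ 0 < ε :=
    (((hev1.and hev2).filter_mono nhdsWithin_le_nhds).and
      (self_mem_nhdsWithin : Set.Ioi (0 : ℝ) ∈ nhdsWithin 0 (Set.Ioi 0))).exists
  let W : Set E := (fun x : E => (ε, r • x)) ⁻¹' O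
  have hW : IsOpen W := hO.preimage (by fun_prop)
  have hGsmooth : ContDiffOn ℝ 1 (fun x : E => G (ε, r • x)) W := by
    let incl : stratumSpan m n s →L[ℝ] stratumSpan m n t :=
      LinearMap.toContinuousLinearMap (Submodule.inclusion (stratumSpan_mono m n hst))
    let c : stratumSpan m n t := ⟨γ (ε, 0), hspan _⟩
    have haff : ContDiff ℝ 1 (fun x : E => c + r • incl (A x)) :=
      contDiff_const.add ((incl.comp A).contDiff.const_smul r)
    have hval : ∀ x : E, ((c + r • incl (A x) : stratumSpan m n t) :
        (Fin m → ℝ) × (Fin n → ℝ)) = γ (ε, r • x) := by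
      intro x
      have : ((incl (A x) : stratumSpan m n t) : (Fin m → ℝ) × (Fin n → ℝ)) = A x := rfl
      simp only [c, γ, Submodule.coe_add, Submodule.coe_smul, this, map_zero, map_smul,
        Submodule.coe_zero]
      abel
    have h1 := hsmooth.comp haff.contDiffOn (s := W) fun x hx => by
      rw [Set.mem_ofPred_eq, hval]
      exact ⟨hOV hx, hstratum _ hx hε.ne'⟩
    refine (L.symm.contDiff.comp_contDiffOn h1).congr fun x _ => ?_
    simp only [G, Function.comp_apply, hval]
  have hrx : ∀ x : E, ‖r • x‖ = r * ‖x‖ := fun x => by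
    rw [norm_smul, Real.norm_of_nonneg hr.le]
  have hWball : ∀ x : E, ‖x‖ ≤ 1 → x ∈ W := fun x hx =>
    hεO _ (by rw [mem_closedBall_zero_iff, hrx]; exact mul_le_of_le_one_right hr.le hx)
  obtain ⟨x, hx, hGx⟩ := exists_zero_of_inner_pos_of_contDiffOn hW
    (fun x hx => hWball x (by simpa using hx)) hGsmooth fun x hx => by
      have := hεG (r • x) (by rw [mem_sphere_zero_iff_norm, hrx, hx, mul_one])
      rw [real_inner_smul_left] at this
      exact pos_of_mul_pos_right this hr.le
  exact ⟨γ (ε, r • x), ⟨hOV (hWball x hx), hstratum _ (hWball x hx) hε.ne'⟩,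
    L.symm.map_eq_zero_iff.1 hGx⟩

/-- The interval above `s` in the Boolean cube, restricted to any predicate that holds on it, is a
cube on the coordinates where `s` is false. -/
theorem nonempty_orderIso_boolean_upper (m : ℕ) (s : Fin m → Bool) (P : (Fin m → Bool) → Prop)
    (hP : ∀ t, s ≤ t → P t) :
    Nonempty ({t : Fin m → Bool // P t ∧ s ≤ t} ≃o
      (Fin (m - (Finset.univ.filter fun i => s i = true).card) → Bool)) := by
  have hcard : Fintype.card {i // s i = false} =
      m - (Finset.univ.filter fun i => s i = true).card := by
    have h := Finset.card_filter_add_card_filter_not (s := (Finset.univ : Finset (Fin m)))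
      (fun i => s i = true)
    simp only [Bool.not_eq_true, Finset.card_univ, Fintype.card_fin] at h
    rw [Fintype.card_subtype]
    omega
  let e := Fintype.equivFinOfCardEq hcard
  refine ⟨{ toFun := fun t j => t.1 (e.symm j)
            invFun := fun u => ⟨fun i => if h : s i = false then u (e ⟨i, h⟩) else true, ?_⟩
            left_inv := fun t => ?_
            right_inv := fun u => ?_
            map_rel_iff' := fun {t t'} => ?_ }⟩
  · have hle : s ≤ fun i => if h : s i = false then u (e ⟨i, h⟩) else true := by
      intro i
      by_cases h : s i = false <;> simp [h]
    exact ⟨hP _ hle, hle⟩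
  · ext i
    by_cases h : s i = false
    · simp [h]
    · have := t.2.2 i
      rw [Bool.not_eq_false] at h
      rw [h] at this
      simp [h, Bool.eq_true_of_true_le this]
  · ext j
    have := (e.symm j).2
    simp [this]
  · refine ⟨fun h i => ?_, fun h j => h _⟩
    by_cases hi : s i = false
    · simpa using h (e ⟨i, hi⟩)
    · have := t'.2.2 i
      rw [Bool.not_eq_false] at hi
      rw [hi] at this
      rw [Bool.eq_true_of_true_le this]
      exact Bool.le_true _

/-- The stratification poset `Δ(ψ)` of a cutout locus is cubical: for every
`s ∈ Δ(ψ)`, the subposet `{t ∈ Δ(ψ) | s ≤ t}` is order-isomorphic to the Boolean cube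
`Fin (m - d(s)) → Bool`, where `d(s) = #{i | s i = true}`. -/
theorem stratification_poset_cubical
    (m n ℓ : ℕ) (V : Set ((Fin m → ℝ) × (Fin n → ℝ)))
    (hVopen : ∃ U : Set ((Fin m → ℝ) × (Fin n → ℝ)), IsOpen U ∧ V = U ∩ quadrant m n)
    (h0V : (0 : (Fin m → ℝ) × (Fin n → ℝ)) ∈ V)
    (ψ : ((Fin m → ℝ) × (Fin n → ℝ)) → (Fin ℓ → ℝ))
    (hcont : ContinuousOn ψ V)
    (hsmooth : ∀ s : Fin m → Bool,
      ContDiffOn ℝ (⊤ : ℕ∞)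
        (fun p : stratumSpan m n s => ψ (p : (Fin m → ℝ) × (Fin n → ℝ)))
        {p : stratumSpan m n s | (p : (Fin m → ℝ) × (Fin n → ℝ)) ∈ V ∩ stratum m n s})
    (hreg : ∀ (s : Fin m → Bool) (z : stratumSpan m n s),
      (z : (Fin m → ℝ) × (Fin n → ℝ)) ∈ V ∩ stratum m n s →
      ψ (z : (Fin m → ℝ) × (Fin n → ℝ)) = 0 →
      Function.Surjective
        ⇑(fderivWithin ℝ
            (fun p : stratumSpan m n s => ψ (p : (Fin m → ℝ) × (Fin n → ℝ)))
            {p : stratumSpan m n s | (p : (Fin m → ℝ) × (Fin n → ℝ)) ∈ V ∩ stratum m n s}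
            z))
    (s : Fin m → Bool)
    (hsΔ : ∃ p ∈ V ∩ stratum m n s, ψ p = 0) :
    Nonempty
      ({t : Fin m → Bool // (∃ p ∈ V ∩ stratum m n t, ψ p = 0) ∧ s ≤ t} ≃o
        (Fin (m - (Finset.univ.filter fun i => s i = true).card) → Bool)) := by
  obtain ⟨U, hU, rfl⟩ := hVopen
  obtain ⟨p, hp, hψp⟩ := hsΔ
  refine nonempty_orderIso_boolean_upper m s _ fun t hst => ?_
  let z : stratumSpan m n s := ⟨p, (mem_stratum_iff.1 hp.2).2⟩
  have hΩ := (isOpen_preimage_inter_stratum hU s).mem_nhds (show z ∈ _ from hp)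
  have hF : HasFDerivAt (fun q : stratumSpan m n s => ψ q) _ z :=
    (((hsmooth s).differentiableOn (by simp)).differentiableAt hΩ).hasFDerivAt
  refine exists_zero_stratum_of_le (EuclideanSpace.equiv (Fin ℓ) ℝ) hU hcont hst
    ((hsmooth t).of_le (by exact_mod_cast le_top)) hp hψp hF ?_
  rw [← fderivWithin_of_mem_nhds hΩ]
  exact hreg s z hp hψp
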